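/- arXiv:0901.3590 — 6 statements merged into one kernel-verified Lean document; each statement's English description precedes it below -/
import Mathlib

section
/- (Strong duality for ℓ1-regularized AdaBoost.) The optimal value of the primal problem: minimize log( ∑_{i=1}^M exp( −y_i ∑_{j=1}^N H_{ij} w_j ) ) over w ∈ ℝ^N subject to w_j ≥ 0 for all j and ∑_{j=1}^N w_j = 1/T, equals the optimal value of the dual entropy-maximization problem: maximize r/T − ∑_{i=1}^M u_i log u_i over r ∈ ℝ and u ∈ ℝ^M subject to ∑_{i=1}^M u_i y_i H_{ij} ≤ −r for all j = 1,…,N, u_i ≥ 0 for all i, and ∑_{i=1}^M u_i = 1. -/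
open Filter Topology in
/-- First-order optimality on a segment for a sum of exponentials of affine functions. -/
lemma sum_mul_exp_nonneg_of_forall_sum_exp_le {ι : Type*} [Fintype ι] (z d : ι → ℝ)
    (h : ∀ t : ℝ, 0 < t → t ≤ 1 → ∑ i, Real.exp (z i) ≤ ∑ i, Real.exp (z i + t * d i)) :
    0 ≤ ∑ i, Real.exp (z i) * d i := by
  have hcont : Continuous fun t : ℝ => ∑ i, Real.exp (z i + t * d i) * d i := by fun_prop
  have hlim : Tendsto (fun t : ℝ => ∑ i, Real.exp (z i + t * d i) * d i) (𝓝[>] 0)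
      (𝓝 (∑ i, Real.exp (z i) * d i)) := by
    simpa using (hcont.tendsto 0).mono_left nhdsWithin_le_nhds
  refine ge_of_tendsto hlim ?_
  filter_upwards [Ioc_mem_nhdsGT (zero_lt_one' ℝ)] with t ht
  have hle : ∑ i, (Real.exp (z i + t * d i) - Real.exp (z i)) ≤
      ∑ i, t * (Real.exp (z i + t * d i) * d i) := by
    refine Finset.sum_le_sum fun i _ => ?_
    have hexp : Real.exp (z i) = Real.exp (z i + t * d i) * Real.exp (-(t * d i)) := by
      rw [← Real.exp_add]
      ring_nf
    have := mul_le_mul_of_nonneg_left (Real.add_one_le_exp (-(t * d i)))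
      (Real.exp_pos (z i + t * d i)).le
    linarith
  rw [Finset.sum_sub_distrib, ← Finset.mul_sum] at hle
  exact nonneg_of_mul_nonneg_right (by linarith [h t ht.1 ht.2]) ht.1

/-- A minimizer over the simplex of a sum of exponentials of linear forms, together with its
first-order optimality conditions at the vertices. -/
lemma exists_mem_stdSimplex_sum_exp_optimality {ι κ : Type*} [Fintype ι] [Fintype κ]
    [Nonempty κ] (B : ι → κ → ℝ) :
    ∃ w ∈ stdSimplex ℝ κ, ∀ j, ∑ i, Real.exp (∑ k, B i k * w k) * ∑ k, B i k * w k ≤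
      ∑ i, Real.exp (∑ k, B i k * w k) * B i j := by
  classical
  obtain ⟨w, hw, hmin⟩ := (isCompact_stdSimplex ℝ κ).exists_isMinOn
    ⟨_, single_mem_stdSimplex ℝ (Classical.arbitrary κ)⟩
    (f := fun w => ∑ i, Real.exp (∑ k, B i k * w k)) (by fun_prop)
  refine ⟨w, hw, fun j => ?_⟩
  have := sum_mul_exp_nonneg_of_forall_sum_exp_le (fun i => ∑ k, B i k * w k)
    (fun i => B i j - ∑ k, B i k * w k) fun t ht ht1 => ?_
  · simp only [mul_sub, Finset.sum_sub_distrib] at this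
    linarith
  · have hmem : (1 - t) • w + t • Pi.single j 1 ∈ stdSimplex ℝ κ :=
      convex_stdSimplex ℝ κ hw (single_mem_stdSimplex ℝ j) (by linarith) ht.le (by ring)
    refine (isMinOn_iff.mp hmin _ hmem).trans_eq (Finset.sum_congr rfl fun i _ => ?_)
    have hj : ∑ k, B i k * (t * (Pi.single j 1 : κ → ℝ) k) = t * B i j := by
      simp [Pi.single_apply, mul_comm]
    have hw' : ∑ k, B i k * ((1 - t) * w k) = (1 - t) * ∑ k, B i k * w k := by
      rw [Finset.mul_sum]
      exact Finset.sum_congr rfl fun k _ => by ring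
    simp only [Pi.add_apply, Pi.smul_apply, smul_eq_mul, mul_add, Finset.sum_add_distrib, hj, hw']
    ring_nf

/-- The Gibbs variational inequality for the log-sum-exp function. -/
lemma sum_mul_sub_sum_mul_log_le_log_sum_exp {ι : Type*} [Fintype ι] [Nonempty ι]
    (z u : ι → ℝ) (hu : u ∈ stdSimplex ℝ ι) :
    ∑ i, u i * z i - ∑ i, u i * Real.log (u i) ≤ Real.log (∑ i, Real.exp (z i)) := by
  set S := ∑ i, Real.exp (z i)
  have hS : 0 < S := Finset.sum_pos (fun i _ => Real.exp_pos _) Finset.univ_nonempty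
  have key : ∑ i, (u i * z i - u i * Real.log (u i) - u i * Real.log S) ≤
      ∑ i, (Real.exp (z i) / S - u i) := by
    refine Finset.sum_le_sum fun i _ => ?_
    rcases (hu.1 i).eq_or_lt with h | h
    · simpa [← h] using div_nonneg (Real.exp_pos (z i)).le hS.le
    · have hlog := Real.log_le_sub_one_of_pos (div_pos (div_pos (Real.exp_pos (z i)) hS) h)
      rw [Real.log_div (div_pos (Real.exp_pos _) hS).ne' h.ne',
        Real.log_div (Real.exp_pos _).ne' hS.ne', Real.log_exp] at hlog
      have := mul_le_mul_of_nonneg_left hlog h.le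
      rw [mul_sub (u i) (_ / _), mul_div_cancel₀ _ h.ne'] at this
      linarith
  rw [Finset.sum_sub_distrib, Finset.sum_sub_distrib, Finset.sum_sub_distrib, ← Finset.sum_mul,
    ← Finset.sum_div, hu.2, div_self hS.ne'] at key
  linarith

/-- The softmax distribution attains equality in the Gibbs variational inequality. -/
lemma sum_softmax_mul_sub_sum_mul_log {ι : Type*} [Fintype ι] [Nonempty ι] (z : ι → ℝ) :
    ∑ i, Real.exp (z i) / (∑ k, Real.exp (z k)) * z i -
      ∑ i, Real.exp (z i) / (∑ k, Real.exp (z k)) *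
        Real.log (Real.exp (z i) / ∑ k, Real.exp (z k)) = Real.log (∑ i, Real.exp (z i)) := by
  have hS : 0 < ∑ i, Real.exp (z i) :=
    Finset.sum_pos (fun i _ => Real.exp_pos _) Finset.univ_nonempty
  simp only [Real.log_div (Real.exp_pos _).ne' hS.ne', Real.log_exp, mul_sub,
    Finset.sum_sub_distrib]
  rw [← Finset.sum_mul, ← Finset.sum_div, div_self hS.ne']
  ring

/-- Weak duality for the margins: a bound on each column bounds every nonnegative combination. -/
lemma mul_sum_le_sum_mul_of_forall_le {ι κ : Type*} [Fintype ι] [Fintype κ] (A : ι → κ → ℝ)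
    (u : ι → ℝ) (w : κ → ℝ) (r : ℝ) (hw : ∀ j, 0 ≤ w j) (h : ∀ j, r ≤ ∑ i, u i * A i j) :
    r * ∑ j, w j ≤ ∑ i, u i * ∑ j, A i j * w j := by
  simp only [Finset.mul_sum, ← mul_assoc]
  rw [Finset.sum_comm]
  simp only [← Finset.sum_mul]
  exact Finset.sum_le_sum fun j _ => mul_le_mul_of_nonneg_right (h j) (hw j)


/-- Strong duality for ℓ1-regularized AdaBoost: the optimal value of the primal
log-sum-exp minimization over the scaled simplex equals the optimal value of the
dual entropy-maximization problem. -/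
theorem adaboost_l1_strong_duality (M N : ℕ) (hM : 0 < M) (hN : 0 < N)
    (H : Fin M → Fin N → ℝ) (y : Fin M → ℝ) (hy : ∀ i, y i = 1 ∨ y i = -1)
    (T : ℝ) (hT : 0 < T) :
    sInf {v : ℝ | ∃ w : Fin N → ℝ, (∀ j, 0 ≤ w j) ∧ (∑ j, w j = 1 / T) ∧
        v = Real.log (∑ i, Real.exp (- y i * ∑ j, H i j * w j))}
    = sSup {v : ℝ | ∃ (r : ℝ) (u : Fin M → ℝ),
        (∀ j, ∑ i, u i * y i * H i j ≤ - r) ∧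
        (∀ i, 0 ≤ u i) ∧ (∑ i, u i = 1) ∧
        v = r / T - ∑ i, u i * Real.log (u i)} := by
  have : Nonempty (Fin M) := ⟨⟨0, hM⟩⟩
  have : Nonempty (Fin N) := ⟨⟨0, hN⟩⟩
  have hz (w : Fin N → ℝ) (i : Fin M) :
      - y i * ∑ j, H i j * w j = ∑ j, (- y i * H i j) * w j := by
    simp only [Finset.mul_sum, mul_assoc]
  obtain ⟨w, hw, hopt⟩ :=
    exists_mem_stdSimplex_sum_exp_optimality fun i j => (- y i * H i j) / T
  set z : Fin M → ℝ := fun i => ∑ k, (- y i * H i k) / T * w k with hzdef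
  set S : ℝ := ∑ i, Real.exp (z i)
  have hS : 0 < S := Finset.sum_pos (fun i _ => Real.exp_pos _) Finset.univ_nonempty
  have hweak : ∀ a ∈ {v : ℝ | ∃ w : Fin N → ℝ, (∀ j, 0 ≤ w j) ∧ (∑ j, w j = 1 / T) ∧
        v = Real.log (∑ i, Real.exp (- y i * ∑ j, H i j * w j))},
      ∀ b ∈ {v : ℝ | ∃ (r : ℝ) (u : Fin M → ℝ),
        (∀ j, ∑ i, u i * y i * H i j ≤ - r) ∧ (∀ i, 0 ≤ u i) ∧ (∑ i, u i = 1) ∧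
        v = r / T - ∑ i, u i * Real.log (u i)}, b ≤ a := by
    rintro _ ⟨w, hw0, hw1, rfl⟩ _ ⟨r, u, hr, hu0, hu1, rfl⟩
    simp only [hz]
    refine le_trans (sub_le_sub_right ?_ _)
      (sum_mul_sub_sum_mul_log_le_log_sum_exp _ u ⟨hu0, hu1⟩)
    rw [div_eq_mul_one_div, ← hw1]
    refine mul_sum_le_sum_mul_of_forall_le _ u w r hw0 fun j => ?_
    have := hr j
    simp only [neg_mul, mul_neg, Finset.sum_neg_distrib, ← mul_assoc]
    linarith
  have hprimal : Real.log S ∈ {v : ℝ | ∃ w : Fin N → ℝ, (∀ j, 0 ≤ w j) ∧ (∑ j, w j = 1 / T) ∧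
        v = Real.log (∑ i, Real.exp (- y i * ∑ j, H i j * w j))} := by
    refine ⟨fun j => w j / T, fun j => div_nonneg (hw.1 j) hT.le, ?_, ?_⟩
    · rw [← Finset.sum_div, hw.2]
    · simp only [hz]
      simp only [S, hzdef, div_mul_eq_mul_div, ← mul_div_assoc]
  have hdual : Real.log S ∈ {v : ℝ | ∃ (r : ℝ) (u : Fin M → ℝ),
        (∀ j, ∑ i, u i * y i * H i j ≤ - r) ∧ (∀ i, 0 ≤ u i) ∧ (∑ i, u i = 1) ∧
        v = r / T - ∑ i, u i * Real.log (u i)} := by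
    refine ⟨T * ∑ i, Real.exp (z i) / S * z i, fun i => Real.exp (z i) / S, fun j => ?_,
      fun i => div_nonneg (Real.exp_pos _).le hS.le, ?_, ?_⟩
    · have hj := mul_le_mul_of_nonneg_left (hopt j) (div_pos hT hS).le
      have hl : T / S * ∑ i, Real.exp (z i) * z i = T * ∑ i, Real.exp (z i) / S * z i := by
        simp only [Finset.mul_sum]
        exact Finset.sum_congr rfl fun i _ => by ring
      have hr : T / S * ∑ i, Real.exp (z i) * (- y i * H i j / T) =
          -∑ i, Real.exp (z i) / S * y i * H i j := by
        rw [Finset.mul_sum, ← Finset.sum_neg_distrib]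
        exact Finset.sum_congr rfl fun i _ => by field_simp
      linarith
    · rw [← Finset.sum_div, div_self hS.ne']
    · rw [mul_div_cancel_left₀ _ hT.ne']
      exact (sum_softmax_mul_sub_sum_mul_log z).symm
  have hmin : IsLeast _ (Real.log S) := ⟨hprimal, fun a ha => hweak a ha _ hdual⟩
  have hmax : IsGreatest _ (Real.log S) := ⟨hdual, fun b hb => hweak _ hprimal b hb⟩
  rw [hmin.csInf_eq, hmax.csSup_eq]
end

section
/- (Soft-margin LPBoost duality.) Let D ≥ 1/M. The optimal value of the primal problem: maximize ϱ − D ∑_{i=1}^M ξ_i over w ∈ ℝ^N, ϱ ∈ ℝ, ξ ∈ ℝ^M subject to y_i ∑_{j=1}^N H_{ij} w_j ≥ ϱ − ξ_i for all i, w_j ≥ 0 for all j, ∑_{j=1}^N w_j = 1, and ξ_i ≥ 0 for all i, equals the optimal value of the dual problem: minimize r over r ∈ ℝ and u ∈ ℝ^M subject to ∑_{i=1}^M u_i y_i H_{ij} ≤ r for all j = 1,…,N, 0 ≤ u_i ≤ D for all i, and ∑_{i=1}^M u_i = 1. -/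
/-- Theorem of the alternative: either some convex combination of the points `p i` is bounded
above by `b`, or a nonnegative functional is strictly larger on every `p i` than on `b`. -/
theorem exists_convex_combination_le_or_exists_nonneg_separating {ι κ : Type*} [Fintype ι]
    [Fintype κ] (p : ι → κ → ℝ) (b : κ → ℝ) :
    (∃ u ∈ stdSimplex ℝ ι, ∀ k, ∑ i, u i * p i k ≤ b k) ∨
      ∃ c : κ → ℝ, (∀ k, 0 ≤ c k) ∧ ∀ i, ∑ k, b k * c k < ∑ k, p i k * c k := by
  classical
  rw [or_iff_not_imp_left]
  intro hno
  have hcompact : IsCompact (Fintype.linearCombination ℝ p '' stdSimplex ℝ ι) :=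
    (isCompact_stdSimplex ℝ ι).image (LinearMap.continuous_of_finiteDimensional _)
  have hdisj : Disjoint (Set.Iic b) (Fintype.linearCombination ℝ p '' stdSimplex ℝ ι) := by
    rw [Set.disjoint_left]
    rintro _ hz ⟨u, hu, rfl⟩
    refine hno ⟨u, hu, fun k => ?_⟩
    simpa [Fintype.linearCombination_apply] using hz k
  obtain ⟨f, s, t, hfs, hst, hft⟩ := geometric_hahn_banach_closed_compact (convex_Iic b)
    isClosed_Iic ((convex_stdSimplex ℝ ι).linear_image _) hcompact hdisj
  have hf (x : κ → ℝ) : f x = ∑ k, x k * f (Pi.single k 1) := by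
    conv_lhs => rw [pi_eq_sum_univ' x]
    simp [map_sum]
  have hb : f b < s := hfs b (Set.mem_Iic.2 le_rfl)
  refine ⟨fun k => f (Pi.single k 1), fun k => ?_, fun i => ?_⟩
  · by_contra! hk
    have hle : b - ((f b - s) / f (Pi.single k 1)) • Pi.single k (1 : ℝ) ≤ b :=
      sub_le_self _ (smul_nonneg (div_nonneg_of_nonpos (by linarith) hk.le)
        (Pi.single_nonneg.2 zero_le_one))
    have := hfs _ hle
    rw [map_sub, map_smul, smul_eq_mul, div_mul_cancel₀ _ hk.ne] at this
    linarith
  · rw [← hf, ← hf]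
    have := hft (p i) ⟨Pi.single i 1, single_mem_stdSimplex ℝ i, by simp⟩
    linarith

/-- At every level `t`, either the dual soft-margin program or the primal one attains `t`. -/
theorem softMargin_dual_or_primal_attains {ι κ : Type*} [Fintype ι] [Fintype κ] [Nonempty ι]
    (A : ι → κ → ℝ) {D : ℝ} (hD : 1 / (Fintype.card ι : ℝ) ≤ D) (t : ℝ) :
    (∃ u ∈ stdSimplex ℝ ι, (∀ i, u i ≤ D) ∧ ∀ j, ∑ i, u i * A i j ≤ t) ∨
      ∃ w ∈ stdSimplex ℝ κ, ∃ (ϱ : ℝ) (ξ : ι → ℝ), (∀ i, 0 ≤ ξ i) ∧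
        (∀ i, ϱ - ξ i ≤ ∑ j, A i j * w j) ∧ ϱ - D * ∑ i, ξ i = t := by
  classical
  obtain ⟨u, hu, h⟩ | ⟨c, hc, h⟩ := exists_convex_combination_le_or_exists_nonneg_separating
    (fun i => Sum.elim (A i) (Pi.single i 1)) (Sum.elim (fun _ => t) (fun _ => D))
  · refine .inl ⟨u, hu, fun i => ?_, fun j => by simpa using h (.inl j)⟩
    simpa [Pi.single_apply] using h (.inr i)
  · simp only [Fintype.sum_sum_type, Sum.elim_inl, Sum.elim_inr, ← Finset.mul_sum] at h
    simp only [Pi.single_apply, ite_mul, one_mul, zero_mul, Finset.sum_ite_eq',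
      Finset.mem_univ, if_true] at h
    set S := ∑ j, c (.inl j) with hS
    have hSpos : 0 < S := by
      refine (Finset.sum_nonneg fun j _ => hc (.inl j)).lt_of_ne fun hS0 => ?_
      have hw : ∀ j, c (.inl j) = 0 := fun j =>
        (Finset.sum_eq_zero_iff_of_nonneg fun j _ => hc (.inl j)).1 hS0.symm j (Finset.mem_univ j)
      have hlt := Finset.sum_lt_sum_of_nonempty Finset.univ_nonempty fun i _ => h i
      have hcard : (0 : ℝ) < Fintype.card ι := by exact_mod_cast Fintype.card_pos
      rw [div_le_iff₀ hcard] at hD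
      have hξ : 0 ≤ ∑ i, c (.inr i) := Finset.sum_nonneg fun i _ => hc (.inr i)
      simp only [hS, hw, mul_zero, zero_add, Finset.sum_const_zero, Finset.sum_const,
        Finset.card_univ, nsmul_eq_mul] at hlt
      nlinarith
    refine .inr ⟨fun j => c (.inl j) / S, ⟨fun j => div_nonneg (hc _) hSpos.le, ?_⟩,
      t + D * ∑ i, c (.inr i) / S, fun i => c (.inr i) / S,
      fun i => div_nonneg (hc _) hSpos.le, fun i => ?_, by ring⟩
    · rw [← Finset.sum_div, div_self hSpos.ne']
    · simp only [← mul_div_assoc, ← Finset.sum_div]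
      rw [← sub_nonneg]
      have key := h i
      have : (∑ j, A i j * c (.inl j)) / S - (t + D * (∑ i, c (.inr i)) / S - c (.inr i) / S)
          = (∑ j, A i j * c (.inl j) + c (.inr i) - (t * S + D * ∑ i, c (.inr i))) / S := by
        field_simp
        ring
      rw [this]
      exact div_nonneg (by linarith) hSpos.le

/-- Weak duality for the soft-margin program. -/
theorem softMargin_weak_duality {ι κ : Type*} [Fintype ι] [Fintype κ] {A : ι → κ → ℝ}
    {D ϱ r : ℝ} {w : κ → ℝ} {ξ u : ι → ℝ} (hw : w ∈ stdSimplex ℝ κ) (hu : u ∈ stdSimplex ℝ ι)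
    (hξ : ∀ i, 0 ≤ ξ i) (hmargin : ∀ i, ϱ - ξ i ≤ ∑ j, A i j * w j) (huD : ∀ i, u i ≤ D)
    (hr : ∀ j, ∑ i, u i * A i j ≤ r) : ϱ - D * ∑ i, ξ i ≤ r :=
  calc ϱ - D * ∑ i, ξ i = ∑ i, (u i * ϱ - D * ξ i) := by
        rw [Finset.sum_sub_distrib, ← Finset.sum_mul, hu.2, one_mul, Finset.mul_sum]
    _ ≤ ∑ i, u i * ∑ j, A i j * w j := Finset.sum_le_sum fun i _ => by
        nlinarith [mul_le_mul_of_nonneg_left (hmargin i) (hu.1 i),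
          mul_le_mul_of_nonneg_right (huD i) (hξ i)]
    _ = ∑ j, (∑ i, u i * A i j) * w j := by
        simp only [Finset.mul_sum, Finset.sum_mul, mul_assoc]
        exact Finset.sum_comm
    _ ≤ ∑ j, r * w j := Finset.sum_le_sum fun j _ => mul_le_mul_of_nonneg_right (hr j) (hw.1 j)
    _ = r := by rw [← Finset.mul_sum, hw.2, mul_one]

/-- Soft-margin LPBoost duality: for `D ≥ 1/M`, the optimal value of the soft-margin
primal equals the optimal value of its dual, in which the sample weights are capped
at `D`. -/
theorem lpboost_soft_margin_duality (M N : ℕ) (hM : 0 < M) (hN : 0 < N)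
    (H : Fin M → Fin N → ℝ) (y : Fin M → ℝ) (hy : ∀ i, y i = 1 ∨ y i = -1)
    (D : ℝ) (hD : 1 / (M : ℝ) ≤ D) :
    sSup {c : ℝ | ∃ (w : Fin N → ℝ) (ϱ : ℝ) (ξ : Fin M → ℝ),
        (∀ i, y i * (∑ j, H i j * w j) ≥ ϱ - ξ i) ∧
        (∀ j, 0 ≤ w j) ∧ (∑ j, w j = 1) ∧ (∀ i, 0 ≤ ξ i) ∧
        c = ϱ - D * ∑ i, ξ i}
    = sInf {c : ℝ | ∃ (r : ℝ) (u : Fin M → ℝ),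
        (∀ j, ∑ i, u i * y i * H i j ≤ r) ∧
        (∀ i, 0 ≤ u i) ∧ (∀ i, u i ≤ D) ∧ (∑ i, u i = 1) ∧
        c = r} := by
  have : Nonempty (Fin M) := ⟨⟨0, hM⟩⟩
  have hmargin (w : Fin N → ℝ) (i : Fin M) :
      y i * ∑ j, H i j * w j = ∑ j, y i * H i j * w j := by
    simp only [Finset.mul_sum, mul_assoc]
  simp only [hmargin, mul_assoc (_ : ℝ) (y _) (H _ _)]
  set P := {c : ℝ | ∃ (w : Fin N → ℝ) (ϱ : ℝ) (ξ : Fin M → ℝ), _}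
  set Q := {c : ℝ | ∃ (r : ℝ) (u : Fin M → ℝ), _}
  have hPQ : ∀ c ∈ P, ∀ d ∈ Q, c ≤ d := by
    rintro _ ⟨w, ϱ, ξ, hm, hw0, hw1, hξ, rfl⟩ _ ⟨r, u, hr, hu0, huD, hu1, rfl⟩
    exact softMargin_weak_duality ⟨hw0, hw1⟩ ⟨hu0, hu1⟩ hξ hm huD hr
  have halt (t : ℝ) : t ∈ Q ∨ t ∈ P := by
    obtain ⟨u, hu, huD, hr⟩ | ⟨w, hw, ϱ, ξ, hξ, hm, ht⟩ :=
      softMargin_dual_or_primal_attains (fun i j => y i * H i j) (D := D) (by simpa using hD) t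
    · exact .inl ⟨t, u, hr, hu.1, huD, hu.2, rfl⟩
    · exact .inr ⟨w, ϱ, ξ, hm, hw.1, hw.2, hξ, ht.symm⟩
  have hP : P.Nonempty := by
    let w : Fin N → ℝ := Pi.single ⟨0, hN⟩ 1
    have hw : w ∈ stdSimplex ℝ (Fin N) := single_mem_stdSimplex ℝ _
    exact ⟨_, w, 0, fun i => |∑ j, y i * H i j * w j|,
      fun i => by simpa using neg_abs_le (∑ j, y i * H i j * w j), hw.1, hw.2,
      fun i => abs_nonneg _, rfl⟩
  have hQ : Q.Nonempty := by
    refine ⟨_, ∑ j, |∑ i, 1 / (M : ℝ) * (y i * H i j)|, fun _ => 1 / (M : ℝ), fun j => ?_,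
      fun _ => by positivity, fun _ => hD, by simp [hM.ne'], rfl⟩
    exact (le_abs_self _).trans
      (Finset.single_le_sum (f := fun j => |∑ i, 1 / (M : ℝ) * (y i * H i j)|)
        (fun _ _ => abs_nonneg _) (Finset.mem_univ j))
  have hPbdd : BddAbove P := hQ.imp fun d hd c hc => hPQ c hc d hd
  have hQbdd : BddBelow Q := hP.imp fun c hc d hd => hPQ c hc d hd
  refine le_antisymm (csSup_le hP fun c hc => le_csInf hQ (hPQ c hc)) (le_of_not_gt fun hlt => ?_)
  obtain ⟨t, hPt, htQ⟩ := exists_between hlt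
  obtain ht | ht := halt t
  · exact htQ.not_ge (csInf_le hQbdd ht)
  · exact hPt.not_ge (le_csSup hPbdd ht)
end

section
/- (Duality for soft-margin LPBoost with squared hinge loss.) Let D > 0. The optimal value of the primal problem: maximize ϱ − D ∑_{i=1}^M ξ_i² over w ∈ ℝ^N, ϱ ∈ ℝ, ξ ∈ ℝ^M subject to y_i ∑_{j=1}^N H_{ij} w_j ≥ ϱ − ξ_i for all i, w_j ≥ 0 for all j, and ∑_{j=1}^N w_j = 1, equals the optimal value of the dual problem: minimize r + (1/(4D)) ∑_{i=1}^M u_i² over r ∈ ℝ and u ∈ ℝ^M subject to ∑_{i=1}^M u_i y_i H_{ij} ≤ r for all j = 1,…,N, u_i ≥ 0 for all i, and ∑_{i=1}^M u_i = 1. -/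
lemma nonneg_of_forall_add_mul_nonneg {c K : ℝ} (hK : 0 ≤ K)
    (h : ∀ t, 0 < t → t ≤ 1 → 0 ≤ c + t * K) : 0 ≤ c := by
  by_contra! hc
  have hpos : 0 < K - c := by linarith
  have key := h (-c / (K - c)) (div_pos (by linarith) hpos)
    ((div_le_one hpos).2 (by linarith))
  have heq : c + -c / (K - c) * K = -(c ^ 2 / (K - c)) := by
    field_simp
    ring
  have : 0 < c ^ 2 / (K - c) := div_pos (sq_pos_of_neg hc) hpos
  linarith

/-- First-order optimality condition for minimizing a linear function plus a multiple of the squared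
Euclidean norm over a convex set. -/
lemma Convex.linear_add_sq_variational {ι : Type*} [Fintype ι] {s : Set (ι → ℝ)} (hs : Convex ℝ s)
    {κ : ℝ} (hκ : 0 ≤ κ) {a u : ι → ℝ} (hu : u ∈ s)
    (hmin : ∀ v ∈ s, ∑ i, u i * a i + κ * ∑ i, u i ^ 2 ≤ ∑ i, v i * a i + κ * ∑ i, v i ^ 2)
    {v : ι → ℝ} (hv : v ∈ s) :
    ∑ i, u i * a i + 2 * κ * ∑ i, u i ^ 2 ≤ ∑ i, v i * a i + 2 * κ * ∑ i, u i * v i := by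
  rw [← sub_nonneg]
  refine nonneg_of_forall_add_mul_nonneg (K := κ * ∑ i, (v i - u i) ^ 2)
    (mul_nonneg hκ (Finset.sum_nonneg fun i _ => sq_nonneg _)) fun t ht ht1 => ?_
  have h := hmin _ (hs hu hv (sub_nonneg.2 ht1) ht.le (by ring))
  refine nonneg_of_mul_nonneg_right (le_of_le_of_eq (sub_nonneg.2 h) ?_) ht
  simp only [Pi.add_apply, Pi.smul_apply, smul_eq_mul, Finset.mul_sum, ← Finset.sum_add_distrib,
    ← Finset.sum_sub_distrib]
  exact Finset.sum_congr rfl fun i _ => by ring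

/-- Regularizing a matrix game by a nonnegative multiple of the squared Euclidean norm of the
minimizing player's strategy preserves the existence of a saddle point. -/
lemma exists_isSaddlePointOn_bilinear_add_sq {m n : Type*} [Fintype m] [Fintype n]
    [Nonempty m] [Nonempty n] (A : m → n → ℝ) {κ : ℝ} (hκ : 0 ≤ κ) :
    ∃ u ∈ stdSimplex ℝ m, ∃ w ∈ stdSimplex ℝ n,
      IsSaddlePointOn (stdSimplex ℝ m) (stdSimplex ℝ n)
        (fun u w => ∑ i, u i * ∑ j, A i j * w j + κ * ∑ i, u i ^ 2) u w := by
  classical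
  refine Sion.exists_isSaddlePointOn ?_ (convex_stdSimplex ℝ m)
    (isCompact_stdSimplex ℝ m) (fun w _ => ?_) (fun w _ => ?_) (convex_stdSimplex ℝ n)
    ?_ (isCompact_stdSimplex ℝ n) (fun u _ => ?_) (fun u _ => ?_)
  · exact ⟨_, single_mem_stdSimplex ℝ (Classical.arbitrary m)⟩
  · exact Continuous.lowerSemicontinuous (by fun_prop) |>.lowerSemicontinuousOn _
  · refine ConvexOn.quasiconvexOn ⟨convex_stdSimplex ℝ m, fun x _ z _ a b ha hb hab => ?_⟩
    obtain rfl : b = 1 - a := by linarith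
    rw [← sub_nonneg]
    have : 0 ≤ κ * ∑ i, a * (1 - a) * (x i - z i) ^ 2 :=
      mul_nonneg hκ (Finset.sum_nonneg fun i _ => mul_nonneg (mul_nonneg ha hb) (sq_nonneg _))
    refine this.trans_eq ?_
    simp only [Pi.add_apply, Pi.smul_apply, smul_eq_mul, mul_add,
      Finset.mul_sum (Finset.univ : Finset m), ← Finset.sum_add_distrib, ← Finset.sum_sub_distrib]
    exact Finset.sum_congr rfl fun i _ => by ring
  · exact ⟨_, single_mem_stdSimplex ℝ (Classical.arbitrary n)⟩
  · exact Continuous.upperSemicontinuous (by fun_prop) |>.upperSemicontinuousOn _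
  · refine ConcaveOn.quasiconcaveOn ⟨convex_stdSimplex ℝ n,
      fun x _ z _ a b ha hb hab => le_of_eq ?_⟩
    obtain rfl : b = 1 - a := by linarith
    have (i : m) : ∑ j, A i j * (a • x + (1 - a) • z) j
        = a * ∑ j, A i j * x j + (1 - a) * ∑ j, A i j * z j := by
      simp only [Pi.add_apply, Pi.smul_apply, smul_eq_mul, Finset.mul_sum,
        ← Finset.sum_add_distrib]
      exact Finset.sum_congr rfl fun j _ => by ring
    simp only [this, smul_eq_mul, mul_add, Finset.mul_sum (Finset.univ : Finset m),
      ← Finset.sum_add_distrib]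
    exact Finset.sum_congr rfl fun i _ => by ring

/-- Weak duality for soft-margin boosting with squared hinge loss. -/
lemma sq_hinge_weak_duality {m n : Type*} [Fintype m] [Fintype n] {A : m → n → ℝ} {D : ℝ}
    (hD : 0 < D) {w : n → ℝ} (hw : w ∈ stdSimplex ℝ n) {ϱ : ℝ} {ξ : m → ℝ}
    (hξ : ∀ i, ϱ - ξ i ≤ ∑ j, A i j * w j) {r : ℝ} {u : m → ℝ} (hu : u ∈ stdSimplex ℝ m)
    (hr : ∀ j, ∑ i, u i * A i j ≤ r) :
    ϱ - D * ∑ i, ξ i ^ 2 ≤ r + 1 / (4 * D) * ∑ i, u i ^ 2 := by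
  have h1 : ϱ - ∑ i, u i * ξ i ≤ ∑ i, u i * ∑ j, A i j * w j := by
    calc ϱ - ∑ i, u i * ξ i = ∑ i, u i * (ϱ - ξ i) := by
          simp only [mul_sub, Finset.sum_sub_distrib, ← Finset.sum_mul, hu.2, one_mul]
      _ ≤ _ := Finset.sum_le_sum fun i _ => mul_le_mul_of_nonneg_left (hξ i) (hu.1 i)
  have h2 : ∑ i, u i * ∑ j, A i j * w j ≤ r := by
    calc ∑ i, u i * ∑ j, A i j * w j = ∑ j, w j * ∑ i, u i * A i j := by
          simp only [Finset.mul_sum]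
          rw [Finset.sum_comm]
          exact Finset.sum_congr rfl fun j _ => Finset.sum_congr rfl fun i _ => by ring
      _ ≤ ∑ j, w j * r := Finset.sum_le_sum fun j _ => mul_le_mul_of_nonneg_left (hr j) (hw.1 j)
      _ = r := by rw [← Finset.sum_mul, hw.2, one_mul]
  have h3 : ∑ i, u i * ξ i ≤ D * ∑ i, ξ i ^ 2 + 1 / (4 * D) * ∑ i, u i ^ 2 := by
    simp only [Finset.mul_sum, ← Finset.sum_add_distrib]
    refine Finset.sum_le_sum fun i _ => ?_
    have hsq : 0 ≤ 1 / (4 * D) * (u i - 2 * D * ξ i) ^ 2 := by positivity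
    have heq : 1 / (4 * D) * (u i - 2 * D * ξ i) ^ 2
        = D * ξ i ^ 2 + 1 / (4 * D) * u i ^ 2 - u i * ξ i := by
      field_simp
      ring
    linarith
  linarith

/-- Strong duality, with attainment on both sides, for soft-margin boosting with squared hinge
loss. -/
lemma sq_hinge_strong_duality {m n : Type*} [Fintype m] [Fintype n] [Nonempty m] [Nonempty n]
    (A : m → n → ℝ) {D : ℝ} (hD : 0 < D) :
    ∃ w ∈ stdSimplex ℝ n, ∃ (ϱ : ℝ) (ξ : m → ℝ), ∃ u ∈ stdSimplex ℝ m, ∃ r : ℝ,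
      (∀ i, ϱ - ξ i ≤ ∑ j, A i j * w j) ∧ (∀ j, ∑ i, u i * A i j ≤ r) ∧
      ϱ - D * ∑ i, ξ i ^ 2 = r + 1 / (4 * D) * ∑ i, u i ^ 2 := by
  classical
  have hκ : 0 ≤ 1 / (4 * D) := by positivity
  obtain ⟨u, hu, w, hw, hsad⟩ := exists_isSaddlePointOn_bilinear_add_sq A hκ
  refine ⟨w, hw, ∑ i, u i * ∑ j, A i j * w j + 2 * (1 / (4 * D)) * ∑ i, u i ^ 2,
    fun i => 2 * (1 / (4 * D)) * u i, u, hu, ∑ i, u i * ∑ j, A i j * w j,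
    fun i => ?_, fun j => ?_, ?_⟩
  · have h := (convex_stdSimplex ℝ m).linear_add_sq_variational hκ hu
      (fun v hv => hsad v hv w hw) (single_mem_stdSimplex ℝ i)
    simp only [Pi.single_apply, ite_mul, one_mul, zero_mul, mul_ite, mul_one, mul_zero,
      Finset.sum_ite_eq', Finset.mem_univ, if_true] at h
    linarith
  · have h := hsad u hu _ (single_mem_stdSimplex ℝ j)
    simpa [Pi.single_apply] using h
  · simp only [mul_pow, ← Finset.mul_sum]
    field_simp
    ring

/-- Duality for soft-margin LPBoost with squared hinge loss: the optimal value of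
the squared-hinge primal equals the optimal value of the variance-regularized
LPBoost dual. -/
theorem lpboost_squared_hinge_duality (M N : ℕ) (hM : 0 < M) (hN : 0 < N)
    (H : Fin M → Fin N → ℝ) (y : Fin M → ℝ) (hy : ∀ i, y i = 1 ∨ y i = -1)
    (D : ℝ) (hD : 0 < D) :
    sSup {c : ℝ | ∃ (w : Fin N → ℝ) (ϱ : ℝ) (ξ : Fin M → ℝ),
        (∀ i, y i * (∑ j, H i j * w j) ≥ ϱ - ξ i) ∧
        (∀ j, 0 ≤ w j) ∧ (∑ j, w j = 1) ∧
        c = ϱ - D * ∑ i, (ξ i) ^ 2}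
    = sInf {c : ℝ | ∃ (r : ℝ) (u : Fin M → ℝ),
        (∀ j, ∑ i, u i * y i * H i j ≤ r) ∧
        (∀ i, 0 ≤ u i) ∧ (∑ i, u i = 1) ∧
        c = r + (1 / (4 * D)) * ∑ i, (u i) ^ 2} := by
  have : Nonempty (Fin M) := ⟨⟨0, hM⟩⟩
  have : Nonempty (Fin N) := ⟨⟨0, hN⟩⟩
  have hA (w : Fin N → ℝ) (i : Fin M) :
      ∑ j, y i * H i j * w j = y i * ∑ j, H i j * w j := by
    simp only [Finset.mul_sum, mul_assoc]
  obtain ⟨w, hw, ϱ, ξ, u, hu, r, hξ, hr, heq⟩ :=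
    sq_hinge_strong_duality (fun i j => y i * H i j) hD
  simp only [hA, ← mul_assoc] at hξ hr
  refine (IsGreatest.csSup_eq ?_).trans (heq.trans (IsLeast.csInf_eq ?_).symm)
  · refine ⟨⟨w, ϱ, ξ, hξ, hw.1, hw.2, rfl⟩, ?_⟩
    rintro _ ⟨w', ϱ', ξ', hξ', hw₁, hw₂, rfl⟩
    rw [heq]
    exact sq_hinge_weak_duality (A := fun i j => y i * H i j) hD ⟨hw₁, hw₂⟩
      (by simpa only [hA] using hξ') hu (by simpa only [← mul_assoc] using hr)
  · refine ⟨⟨r, u, hr, hu.1, hu.2, rfl⟩, ?_⟩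
    rintro _ ⟨r', u', hr', hu₁, hu₂, rfl⟩
    rw [← heq]
    exact sq_hinge_weak_duality (A := fun i j => y i * H i j) hD hw
      (by simpa only [hA] using hξ) ⟨hu₁, hu₂⟩ (by simpa only [← mul_assoc] using hr')
end

section
/- (Duality for soft-margin LPBoost with generalized hinge loss.) Let D > 0, let p > 1, and let q = p/(p−1), so that 1/p + 1/q = 1. The optimal value of the primal problem: maximize ϱ − D ∑_{i=1}^M ξ_i^p over w ∈ ℝ^N, ϱ ∈ ℝ, ξ ∈ ℝ^M subject to y_i ∑_{j=1}^N H_{ij} w_j ≥ ϱ − ξ_i for all i, ξ_i ≥ 0 for all i, w_j ≥ 0 for all j, and ∑_{j=1}^N w_j = 1, equals the optimal value of the dual (Tsallis-entropy-regularized LPBoost) problem: minimize r + D^{1−q} ( p^{1−q} − p^{−q} ) ∑_{i=1}^M u_i^q over r ∈ ℝ and u ∈ ℝ^M subject to ∑_{i=1}^M u_i y_i H_{ij} ≤ r for all j = 1,…,N, u_i ≥ 0 for all i, and ∑_{i=1}^M u_i = 1. -/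
/-- A function minimized at the left endpoint of `[0, 1]` has nonnegative derivative there. -/
theorem deriv_nonneg_of_le_on_unit {g : ℝ → ℝ} {d : ℝ} (hg : HasDerivAt g d 0)
    (hmin : ∀ t, 0 < t → t ≤ 1 → g 0 ≤ g t) : 0 ≤ d := by
  refine ge_of_tendsto hg.tendsto_slope_zero_right ?_
  filter_upwards [Ioc_mem_nhdsGT (zero_lt_one' ℝ)] with t ht
  simp only [zero_add, smul_eq_mul]
  exact mul_nonneg (inv_nonneg.2 ht.1.le) (sub_nonneg.2 (hmin t ht.1 ht.2))

/-- The coefficient of the conjugate of `ξ ↦ D * ξ ^ p`. -/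
theorem conjugate_coeff_eq {D p q : ℝ} (hD : 0 < D) (hpq : p.HolderConjugate q) :
    D ^ (1 - q) * (p ^ (1 - q) - p ^ (-q)) = (D * p) ^ (1 - q) / q := by
  have hp := hpq.pos
  have h1 : p ^ (-q) = p ^ (1 - q) * p⁻¹ := by
    rw [← Real.rpow_neg_one p, ← Real.rpow_add hp]; ring_nf
  have h2 : q⁻¹ = 1 - p⁻¹ := by linarith [hpq.inv_add_inv_eq_one]
  rw [h1, Real.mul_rpow hD.le hp.le, div_eq_mul_inv, h2]
  ring

/-- Fenchel-Young inequality for `ξ ↦ D * ξ ^ p` on the nonnegative reals. -/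
theorem mul_le_mul_rpow_add_conjugate {D p q : ℝ} (hD : 0 < D) (hpq : p.HolderConjugate q)
    {u x : ℝ} (hu : 0 ≤ u) (hx : 0 ≤ x) :
    u * x ≤ D * x ^ p + (D * p) ^ (1 - q) / q * u ^ q := by
  have hp := hpq.pos
  have hA : 0 < D * p := mul_pos hD hp
  have hy := Real.young_inequality_of_nonneg (a := (D * p) ^ p⁻¹ * x)
    (b := (D * p) ^ (-p⁻¹) * u) (by positivity) (by positivity) hpq
  have e1 : (D * p) ^ p⁻¹ * (D * p) ^ (-p⁻¹) = 1 := by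
    rw [← Real.rpow_add hA]; simp
  have e2 : ((D * p) ^ p⁻¹) ^ p = D * p := Real.rpow_inv_rpow hA.le hp.ne'
  have e3 : ((D * p) ^ (-p⁻¹)) ^ q = (D * p) ^ (1 - q) := by
    rw [← Real.rpow_mul hA.le]
    congr 1
    have := hpq.symm.sub_one_mul_conj
    field_simp
    linarith
  rw [Real.mul_rpow (by positivity) hx, Real.mul_rpow (by positivity) hu, e2, e3] at hy
  have e4 : D * p * x ^ p / p = D * x ^ p := by field_simp
  calc u * x = (D * p) ^ p⁻¹ * x * ((D * p) ^ (-p⁻¹) * u) := by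
        linear_combination (-(u * x)) * e1
    _ ≤ _ := hy
    _ = _ := by rw [e4]; ring

/-- Equality case of `mul_le_mul_rpow_add_conjugate`. -/
theorem mul_eq_mul_rpow_add_conjugate {D p q : ℝ} (hD : 0 < D) (hpq : p.HolderConjugate q)
    {u : ℝ} (hu : 0 ≤ u) :
    u * ((D * p) ^ (1 - q) * u ^ (q - 1)) =
      D * ((D * p) ^ (1 - q) * u ^ (q - 1)) ^ p + (D * p) ^ (1 - q) / q * u ^ q := by
  have hp := hpq.pos
  have hA : 0 < D * p := mul_pos hD hp
  have hqp : (q - 1) * p = q := hpq.symm.sub_one_mul_conj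
  have e1 : u * u ^ (q - 1) = u ^ q := by
    rcases hu.eq_or_lt with rfl | hu
    · rw [Real.zero_rpow hpq.symm.pos.ne']; simp
    · nth_rewrite 1 [← Real.rpow_one u]
      rw [← Real.rpow_add hu]; ring_nf
  have e2 : (u ^ (q - 1)) ^ p = u ^ q := by rw [← Real.rpow_mul hu, hqp]
  have e3 : ((D * p) ^ (1 - q)) ^ p = (D * p) ^ (1 - q) * (D * p)⁻¹ := by
    rw [← Real.rpow_mul hA.le, ← Real.rpow_neg_one (D * p), ← Real.rpow_add hA]
    congr 1
    linarith
  have h2 : q⁻¹ = 1 - p⁻¹ := by linarith [hpq.inv_add_inv_eq_one]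
  rw [Real.mul_rpow (x := (D * p) ^ (1 - q)) (by positivity) (by positivity), e2, e3, mul_left_comm, e1,
    div_eq_mul_inv, h2]
  field_simp
  ring

theorem convexOn_sum_rpow {ι : Type*} [Fintype ι] {q : ℝ} (hq : 1 ≤ q) :
    ConvexOn ℝ (stdSimplex ℝ ι) fun u => ∑ i, u i ^ q := by
  refine ⟨convex_stdSimplex ℝ ι, fun u hu v hv a b ha hb hab => ?_⟩
  simp only [smul_eq_mul, Finset.mul_sum, ← Finset.sum_add_distrib]
  exact Finset.sum_le_sum fun i _ => (convexOn_rpow hq).2 (hu.1 i) (hv.1 i) ha hb hab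

/-- First-order optimality over the simplex of `u ↦ ∑ i, u i * m i + K * ∑ i, u i ^ q`. -/
theorem simplex_first_order {ι : Type*} [Fintype ι] {q K : ℝ} (hq : 1 ≤ q) {m u : ι → ℝ}
    (hu : u ∈ stdSimplex ℝ ι)
    (hmin : ∀ v ∈ stdSimplex ℝ ι,
      ∑ i, u i * m i + K * ∑ i, u i ^ q ≤ ∑ i, v i * m i + K * ∑ i, v i ^ q) (k : ι) :
    ∑ i, u i * (m i + K * q * u i ^ (q - 1)) ≤ m k + K * q * u k ^ (q - 1) := by
  classical
  set e : ι → ℝ := Pi.single k 1 with he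
  have hd : ∀ i, HasDerivAt (fun t : ℝ => u i + t * (e i - u i)) (e i - u i) 0 := fun i => by
    simpa using ((hasDerivAt_id (0 : ℝ)).mul_const (e i - u i)).const_add (u i)
  have hderiv : HasDerivAt (fun t : ℝ => ∑ i, (u i + t * (e i - u i)) * m i
      + K * ∑ i, (u i + t * (e i - u i)) ^ q)
      (∑ i, (e i - u i) * m i + K * ∑ i, (e i - u i) * q * u i ^ (q - 1)) 0 := by
    refine (HasDerivAt.fun_sum fun i _ => (hd i).mul_const (m i)).add
      ((HasDerivAt.fun_sum fun i _ => ?_).const_mul K)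
    simpa using (hd i).rpow_const (p := q) (Or.inr hq)
  have hnn := deriv_nonneg_of_le_on_unit hderiv fun t ht0 ht1 => by
    have hv := (convex_stdSimplex ℝ ι).add_smul_sub_mem hu (single_mem_stdSimplex ℝ k)
      ⟨ht0.le, ht1⟩
    simpa [he] using hmin _ hv
  have hrw : ∑ i, (e i - u i) * m i + K * ∑ i, (e i - u i) * q * u i ^ (q - 1)
      = ∑ i, e i * (m i + K * q * u i ^ (q - 1))
        - ∑ i, u i * (m i + K * q * u i ^ (q - 1)) := by
    rw [Finset.mul_sum, ← Finset.sum_add_distrib, ← Finset.sum_sub_distrib]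
    exact Finset.sum_congr rfl fun i _ => by ring
  have hek : ∑ i, e i * (m i + K * q * u i ^ (q - 1)) = m k + K * q * u k ^ (q - 1) := by
    simp [he, Pi.single_apply]
  linarith

/-- Existence of a saddle point of a matrix game with a convex power regularizer. -/
theorem exists_saddlePoint_regularized_game {ι κ : Type*} [Fintype ι] [Fintype κ] [Nonempty ι]
    [Nonempty κ] (G : ι → κ → ℝ) {q K : ℝ} (hq : 1 ≤ q) (hK : 0 ≤ K) :
    ∃ u ∈ stdSimplex ℝ ι, ∃ w ∈ stdSimplex ℝ κ,
      IsSaddlePointOn (stdSimplex ℝ ι) (stdSimplex ℝ κ)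
        (fun u w => ∑ i, u i * (∑ j, G i j * w j) + K * ∑ i, u i ^ q) u w := by
  classical
  have hq0 : 0 ≤ q := zero_le_one.trans hq
  refine Sion.exists_isSaddlePointOn
    ⟨_, single_mem_stdSimplex ℝ (Classical.arbitrary ι)⟩ (convex_stdSimplex ℝ ι)
    (isCompact_stdSimplex ℝ ι) (fun w _ => ?_) (fun w _ => ?_) (convex_stdSimplex ℝ κ)
    ⟨_, single_mem_stdSimplex ℝ (Classical.arbitrary κ)⟩ (isCompact_stdSimplex ℝ κ)
    (fun u _ => ?_) (fun u _ => ?_)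
  · refine Continuous.lowerSemicontinuous ?_ |>.lowerSemicontinuousOn _
    have : ∀ i, Continuous fun u : ι → ℝ => u i ^ q := fun i =>
      (continuous_apply i).rpow_const fun _ => Or.inr hq0
    fun_prop
  · refine ConvexOn.quasiconvexOn (ConvexOn.add ?_ ((convexOn_sum_rpow hq).smul hK))
    refine ⟨convex_stdSimplex ℝ ι, fun u _ v _ a b _ _ _ => le_of_eq ?_⟩
    simp only [Pi.add_apply, Pi.smul_apply, smul_eq_mul, add_mul, Finset.sum_add_distrib,
      Finset.mul_sum, mul_assoc]
  · refine Continuous.upperSemicontinuous ?_ |>.upperSemicontinuousOn _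
    fun_prop
  · refine ConcaveOn.quasiconcaveOn (ConcaveOn.add_const ?_ _)
    refine ⟨convex_stdSimplex ℝ κ, fun v _ w _ a b _ _ _ => le_of_eq ?_⟩
    simp only [Pi.add_apply, Pi.smul_apply, smul_eq_mul, mul_add, Finset.sum_add_distrib,
      Finset.mul_sum, mul_left_comm]


/-- Duality for soft-margin LPBoost with generalized hinge loss of exponent `p > 1`:
the optimal primal value equals the optimal value of the Tsallis-entropy-regularized
LPBoost dual, where `q = p/(p-1)` is the conjugate exponent. -/
theorem lpboost_generalized_hinge_duality (M N : ℕ) (hM : 0 < M) (hN : 0 < N)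
    (H : Fin M → Fin N → ℝ) (y : Fin M → ℝ) (hy : ∀ i, y i = 1 ∨ y i = -1)
    (D : ℝ) (hD : 0 < D) (p q : ℝ) (hp : 1 < p) (hq : q = p / (p - 1)) :
    sSup {c : ℝ | ∃ (w : Fin N → ℝ) (ϱ : ℝ) (ξ : Fin M → ℝ),
        (∀ i, y i * (∑ j, H i j * w j) ≥ ϱ - ξ i) ∧
        (∀ i, 0 ≤ ξ i) ∧ (∀ j, 0 ≤ w j) ∧ (∑ j, w j = 1) ∧
        c = ϱ - D * ∑ i, (ξ i) ^ p}
    = sInf {c : ℝ | ∃ (r : ℝ) (u : Fin M → ℝ),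
        (∀ j, ∑ i, u i * y i * H i j ≤ r) ∧
        (∀ i, 0 ≤ u i) ∧ (∑ i, u i = 1) ∧
        c = r + D ^ (1 - q) * (p ^ (1 - q) - p ^ (-q)) * ∑ i, (u i) ^ q} := by
  have hp1 : 0 < p - 1 := sub_pos.2 hp
  have hpq : p.HolderConjugate q := by
    rw [hq]; exact Real.HolderConjugate.conjExponent hp
  have hq1 : 1 < q := hpq.symm.lt
  rw [conjugate_coeff_eq hD hpq]
  set K := (D * p) ^ (1 - q) / q with hKdef
  have hK : 0 ≤ K := by have := hpq.symm.pos; have := hpq.pos; positivity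
  have hKq : K * q = (D * p) ^ (1 - q) := div_mul_cancel₀ _ hpq.symm.pos.ne'
  have : Nonempty (Fin M) := ⟨⟨0, hM⟩⟩
  have : Nonempty (Fin N) := ⟨⟨0, hN⟩⟩
  have hswap : ∀ (u : Fin M → ℝ) (w : Fin N → ℝ),
      ∑ j, w j * ∑ i, u i * y i * H i j = ∑ i, u i * (y i * ∑ j, H i j * w j) := fun u w => by
    simp only [Finset.mul_sum]
    rw [Finset.sum_comm]
    exact Finset.sum_congr rfl fun i _ => Finset.sum_congr rfl fun j _ => by ring
  obtain ⟨u, hu, w, hw, hs⟩ :=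
    exists_saddlePoint_regularized_game (fun i j => y i * H i j) hq1.le hK
  simp only [IsSaddlePointOn, mul_assoc, ← Finset.mul_sum] at hs
  set m : Fin M → ℝ := fun i => y i * ∑ j, H i j * w j with hm
  set x : Fin M → ℝ := fun i => (D * p) ^ (1 - q) * u i ^ (q - 1) with hx
  have hfoc := simplex_first_order hq1.le hu fun v hv => hs v hv w hw
  rw [hKq] at hfoc
  have hx0 : ∀ i, 0 ≤ x i := fun i =>
    mul_nonneg (Real.rpow_nonneg (mul_pos hD hpq.pos).le _) (Real.rpow_nonneg (hu.1 i) _)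
  have hval : ∑ i, u i * (m i + x i) - D * ∑ i, x i ^ p
      = ∑ i, u i * m i + K * ∑ i, u i ^ q := by
    simp only [Finset.mul_sum, ← Finset.sum_add_distrib, ← Finset.sum_sub_distrib]
    exact Finset.sum_congr rfl fun i _ => by
      linear_combination mul_eq_mul_rpow_add_conjugate hD hpq (hu.1 i)
  have hweak : ∀ (w : Fin N → ℝ) (ϱ : ℝ) (ξ : Fin M → ℝ) (r : ℝ) (u : Fin M → ℝ),
      (∀ i, y i * (∑ j, H i j * w j) ≥ ϱ - ξ i) → (∀ i, 0 ≤ ξ i) → (∀ j, 0 ≤ w j) →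
      (∑ j, w j = 1) → (∀ j, ∑ i, u i * y i * H i j ≤ r) → (∀ i, 0 ≤ u i) → (∑ i, u i = 1) →
      ϱ - D * ∑ i, ξ i ^ p ≤ r + K * ∑ i, u i ^ q := by
    intro w ϱ ξ r u hmar hξ hw hw1 hr hu hu1
    have h1 : ∑ i, u i * (ϱ - ξ i) ≤ ∑ i, u i * (y i * ∑ j, H i j * w j) :=
      Finset.sum_le_sum fun i _ => mul_le_mul_of_nonneg_left (hmar i) (hu i)
    have h2 : ∑ j, w j * ∑ i, u i * y i * H i j ≤ ∑ j, w j * r :=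
      Finset.sum_le_sum fun j _ => mul_le_mul_of_nonneg_left (hr j) (hw j)
    have h3 : ∑ i, u i * ξ i ≤ ∑ i, (D * ξ i ^ p + K * u i ^ q) :=
      Finset.sum_le_sum fun i _ => mul_le_mul_rpow_add_conjugate hD hpq (hu i) (hξ i)
    rw [hswap, ← Finset.sum_mul, hw1] at h2
    simp only [mul_sub, Finset.sum_sub_distrib, ← Finset.sum_mul, hu1] at h1
    rw [Finset.sum_add_distrib, ← Finset.mul_sum, ← Finset.mul_sum] at h3
    linarith
  have hprimal : ∀ i, y i * (∑ j, H i j * w j) ≥ ∑ i, u i * (m i + x i) - x i := fun i => by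
    have := hfoc i
    simp only [hm, hx] at this ⊢
    linarith
  have hdual : ∀ j, ∑ i, u i * y i * H i j ≤ ∑ i, u i * m i := fun j => by
    have h := hs u hu (Pi.single j 1) (single_mem_stdSimplex ℝ j)
    have h' := hswap u (Pi.single j 1)
    simp only [Pi.single_apply, ite_mul, one_mul, zero_mul, mul_ite, mul_one, mul_zero,
      Finset.sum_ite_eq', Finset.mem_univ, if_true] at h h'
    linarith
  refine (IsGreatest.csSup_eq (a := ∑ i, u i * m i + K * ∑ i, u i ^ q) ⟨?_, ?_⟩).trans
    (IsLeast.csInf_eq ⟨?_, ?_⟩).symm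
  · exact ⟨w, _, x, hprimal, hx0, hw.1, hw.2, hval.symm⟩
  · rintro c ⟨w', ϱ, ξ, h1, h2, h3, h4, rfl⟩
    exact hweak w' ϱ ξ _ u h1 h2 h3 h4 hdual hu.1 hu.2
  · exact ⟨_, u, hdual, hu.1, hu.2, rfl⟩
  · rintro c ⟨r, v, h1, h2, h3, rfl⟩
    rw [← hval]
    exact hweak w _ x r v hprimal hx0 hw.1 hw.2 h1 h2 h3
end

section
/- (Strong duality for LogitBoost.) The optimal value of the primal problem: minimize ∑_{i=1}^M log( 1 + exp( −y_i ∑_{j=1}^N H_{ij} w_j ) ) over w ∈ ℝ^N subject to w_j ≥ 0 for all j and ∑_{j=1}^N w_j = 1/T, equals the optimal value of the dual binary relative entropy maximization problem: maximize r/T − ∑_{i=1}^M [ (−u_i) log(−u_i) + (1 + u_i) log(1 + u_i) ] over r ∈ ℝ and u ∈ ℝ^M subject to −1 ≤ u_i ≤ 0 for all i and ∑_{i=1}^M u_i y_i H_{ij} ≥ r for all j = 1,…,N. -/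
/-- Gibbs' inequality for a single term. -/
theorem mul_log_sub_mul_log_le {p q : ℝ} (hp : 0 ≤ p) (hq : 0 < q) :
    p * Real.log q - p * Real.log p ≤ q - p := by
  rcases hp.eq_or_lt with rfl | hp
  · simpa using hq.le
  · have h := mul_le_mul_of_nonneg_left (Real.log_le_sub_one_of_pos (div_pos hq hp)) hp.le
    rw [Real.log_div hq.ne' hp.ne', mul_sub, mul_sub, mul_div_cancel₀ _ hp.ne'] at h
    linarith

theorem log_exp_div_one_add_exp (x : ℝ) :
    Real.log (Real.exp x / (1 + Real.exp x)) = x - Real.log (1 + Real.exp x) := by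
  rw [Real.log_div (Real.exp_pos x).ne' (by positivity), Real.log_exp]

theorem log_one_sub_exp_div_one_add_exp (x : ℝ) :
    Real.log (1 - Real.exp x / (1 + Real.exp x)) = - Real.log (1 + Real.exp x) := by
  have h : 1 - Real.exp x / (1 + Real.exp x) = (1 + Real.exp x)⁻¹ := by
    have : 1 + Real.exp x ≠ 0 := by positivity
    field_simp
    ring
  rw [h, Real.log_inv]

/-- Fenchel–Young inequality for the logistic loss and the binary entropy. -/
theorem neg_mul_sub_binary_entropy_le {u : ℝ} (h₁ : -1 ≤ u) (h₂ : u ≤ 0) (x : ℝ) :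
    -u * x - ((-u) * Real.log (-u) + (1 + u) * Real.log (1 + u))
      ≤ Real.log (1 + Real.exp x) := by
  have hq : 0 < Real.exp x / (1 + Real.exp x) := by positivity
  have hq' : 0 < 1 - Real.exp x / (1 + Real.exp x) := by
    rw [sub_pos, div_lt_one (by positivity)]
    linarith
  have e₁ := mul_log_sub_mul_log_le (p := -u) (by linarith) hq
  have e₂ := mul_log_sub_mul_log_le (p := 1 + u) (by linarith) hq'
  rw [log_exp_div_one_add_exp] at e₁
  rw [log_one_sub_exp_div_one_add_exp] at e₂
  linarith

theorem hasDerivAt_log_one_add_exp_line (a b : ℝ) :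
    HasDerivAt (fun t : ℝ => Real.log (1 + Real.exp (a + t * b)))
      (Real.exp a / (1 + Real.exp a) * b) 0 := by
  have h : HasDerivAt (fun t : ℝ => a + t * b) b 0 := by
    simpa using ((hasDerivAt_id (0 : ℝ)).mul_const b).const_add a
  have h' := (h.exp.const_add 1).log (by positivity)
  convert h' using 1
  simp only [zero_mul, add_zero]
  ring

theorem HasDerivAt.nonneg_of_forall_le {φ : ℝ → ℝ} {c : ℝ} (h : HasDerivAt φ c 0)
    (hmin : ∀ t, 0 < t → t ≤ 1 → φ 0 ≤ φ t) : 0 ≤ c := by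
  refine ge_of_tendsto h.tendsto_slope_zero_right ?_
  filter_upwards [Ioc_mem_nhdsGT (zero_lt_one (α := ℝ))] with t ht
  have := hmin t ht.1 ht.2
  simp only [zero_add, smul_eq_mul]
  exact mul_nonneg (inv_nonneg.2 ht.1.le) (by linarith)

theorem isCompact_setOf_nonneg_sum_eq (N : ℕ) (s : ℝ) :
    IsCompact {w : Fin N → ℝ | (∀ j, 0 ≤ w j) ∧ ∑ j, w j = s} := by
  refine (isCompact_Icc (a := (0 : Fin N → ℝ)) (b := fun _ => s)).of_isClosed_subset ?_ ?_
  · exact (isClosed_Ici (a := (0 : Fin N → ℝ))).inter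
      (isClosed_eq (by fun_prop) continuous_const)
  · rintro w ⟨h₀, hs⟩
    exact ⟨h₀, fun j => hs ▸ Finset.single_le_sum (fun i _ => h₀ i) (Finset.mem_univ j)⟩


/-- Strong duality for LogitBoost: the optimal value of the ℓ1-constrained logistic
loss minimization equals the optimal value of the dual binary relative entropy
maximization problem. -/
theorem logitboost_strong_duality (M N : ℕ) (hM : 0 < M) (hN : 0 < N)
    (H : Fin M → Fin N → ℝ) (y : Fin M → ℝ) (hy : ∀ i, y i = 1 ∨ y i = -1)
    (T : ℝ) (hT : 0 < T) :
    sInf {v : ℝ | ∃ w : Fin N → ℝ, (∀ j, 0 ≤ w j) ∧ (∑ j, w j = 1 / T) ∧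
        v = ∑ i, Real.log (1 + Real.exp (- y i * ∑ j, H i j * w j))}
    = sSup {v : ℝ | ∃ (r : ℝ) (u : Fin M → ℝ),
        (∀ i, -1 ≤ u i ∧ u i ≤ 0) ∧
        (∀ j, r ≤ ∑ i, u i * y i * H i j) ∧
        v = r / T - ∑ i, ((- u i) * Real.log (- u i)
              + (1 + u i) * Real.log (1 + u i))} := by
  have weak : ∀ w : Fin N → ℝ, (∀ j, 0 ≤ w j) → ∑ j, w j = 1 / T →
      ∀ (r : ℝ) (u : Fin M → ℝ), (∀ i, -1 ≤ u i ∧ u i ≤ 0) →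
      (∀ j, r ≤ ∑ i, u i * y i * H i j) →
      r / T - ∑ i, ((- u i) * Real.log (- u i) + (1 + u i) * Real.log (1 + u i))
        ≤ ∑ i, Real.log (1 + Real.exp (- y i * ∑ j, H i j * w j)) := by
    intro w hw hs r u hu hr
    have h₁ : r / T ≤ ∑ i, -u i * (- y i * ∑ j, H i j * w j) := by
      calc r / T = ∑ j, r * w j := by rw [← Finset.mul_sum, hs]; ring
        _ ≤ ∑ j, (∑ i, u i * y i * H i j) * w j :=
          Finset.sum_le_sum fun j _ => mul_le_mul_of_nonneg_right (hr j) (hw j)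
        _ = ∑ i, -u i * (- y i * ∑ j, H i j * w j) := by
          simp only [Finset.sum_mul, Finset.mul_sum]
          rw [Finset.sum_comm]
          exact Finset.sum_congr rfl fun i _ => Finset.sum_congr rfl fun j _ => by ring
    have h₂ := Finset.sum_le_sum fun i (_ : i ∈ Finset.univ) =>
      neg_mul_sub_binary_entropy_le (hu i).1 (hu i).2 (- y i * ∑ j, H i j * w j)
    rw [Finset.sum_sub_distrib] at h₂
    linarith
  have single_mem : ∀ j₀ : Fin N, (∀ j, 0 ≤ (Pi.single j₀ (1 / T) : Fin N → ℝ) j) ∧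
      ∑ j, (Pi.single j₀ (1 / T) : Fin N → ℝ) j = 1 / T := fun j₀ =>
    ⟨fun j => (Pi.single_nonneg.2 (by positivity) :
      (0 : Fin N → ℝ) ≤ Pi.single j₀ (1 / T)) j, by simp⟩
  obtain ⟨w, ⟨hw, hs⟩, hmin⟩ := (isCompact_setOf_nonneg_sum_eq N (1 / T)).exists_isMinOn
    ⟨_, single_mem ⟨0, hN⟩⟩
    (f := fun w => ∑ i, Real.log (1 + Real.exp (- y i * ∑ j, H i j * w j)))
    (Continuous.continuousOn (continuous_finsetSum _ fun i _ =>
      Continuous.log (by fun_prop) fun w => by positivity))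
  set x : Fin M → ℝ := fun i => - y i * ∑ j, H i j * w j with hx
  set q : Fin M → ℝ := fun i => Real.exp (x i) / (1 + Real.exp (x i)) with hq
  have hq₀ : ∀ i, 0 ≤ q i := fun i => by positivity
  have hq₁ : ∀ i, q i ≤ 1 := fun i => by
    rw [hq, div_le_one (by positivity)]
    linarith
  have hfirst : ∀ j₀, (∑ i, q i * x i) * T ≤ ∑ i, -q i * y i * H i j₀ := by
    intro j₀
    obtain ⟨he, hes⟩ := single_mem j₀
    have hd : HasDerivAt
        (fun t : ℝ => ∑ i, Real.log (1 + Real.exp (x i + t * (- y i * H i j₀ / T - x i))))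
        (∑ i, q i * (- y i * H i j₀ / T - x i)) 0 :=
      HasDerivAt.fun_sum fun i _ => hasDerivAt_log_one_add_exp_line _ _
    have hnn := hd.nonneg_of_forall_le fun t ht₀ ht₁ => by
      have hmem : (fun j => (1 - t) * w j + t * (Pi.single j₀ (1 / T) : Fin N → ℝ) j) ∈
          {w : Fin N → ℝ | (∀ j, 0 ≤ w j) ∧ ∑ j, w j = 1 / T} := by
        refine ⟨fun j => add_nonneg (mul_nonneg (by linarith) (hw j))
          (mul_nonneg ht₀.le (he j)), ?_⟩
        rw [Finset.sum_add_distrib, ← Finset.mul_sum, ← Finset.mul_sum, hs, hes]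
        ring
      have hle := isMinOn_iff.1 hmin _ hmem
      have hline : ∀ i, - y i * ∑ j, H i j *
          ((1 - t) * w j + t * (Pi.single j₀ (1 / T) : Fin N → ℝ) j)
          = x i + t * (- y i * H i j₀ / T - x i) := by
        intro i
        have hsum : ∑ j, H i j * ((1 - t) * w j + t * (Pi.single j₀ (1 / T) : Fin N → ℝ) j)
            = (1 - t) * ∑ j, H i j * w j + t * (H i j₀ * (1 / T)) := by
          have hsingle : ∑ j, H i j * (Pi.single j₀ (1 / T) : Fin N → ℝ) j
              = H i j₀ * (1 / T) := by
            simp [Pi.single_apply]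
          rw [← hsingle, Finset.mul_sum, Finset.mul_sum, ← Finset.sum_add_distrib]
          exact Finset.sum_congr rfl fun j _ => by ring
        rw [hsum, hx]
        ring
      simp only [hline] at hle
      simp only [zero_mul, add_zero]
      exact hle
    have hsplit : ∑ i, q i * (- y i * H i j₀ / T - x i)
        = (∑ i, -q i * y i * H i j₀) / T - ∑ i, q i * x i := by
      rw [Finset.sum_div, ← Finset.sum_sub_distrib]
      exact Finset.sum_congr rfl fun i _ => by ring
    rw [hsplit, sub_nonneg, le_div_iff₀ hT] at hnn
    exact hnn
  have hu : ∀ i, -1 ≤ -q i ∧ -q i ≤ 0 := fun i =>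
    ⟨neg_le_neg (hq₁ i), neg_nonpos.2 (hq₀ i)⟩
  have hval : ∑ i, Real.log (1 + Real.exp (x i)) = (∑ i, q i * x i) * T / T -
      ∑ i, ((- -q i) * Real.log (- -q i) + (1 + -q i) * Real.log (1 + -q i)) := by
    rw [mul_div_cancel_right₀ _ hT.ne', ← Finset.sum_sub_distrib]
    refine Finset.sum_congr rfl fun i _ => ?_
    rw [neg_neg, ← sub_eq_add_neg, log_exp_div_one_add_exp, log_one_sub_exp_div_one_add_exp]
    ring
  have hprimal : IsLeast {v : ℝ | ∃ w : Fin N → ℝ, (∀ j, 0 ≤ w j) ∧ (∑ j, w j = 1 / T) ∧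
      v = ∑ i, Real.log (1 + Real.exp (- y i * ∑ j, H i j * w j))}
      (∑ i, Real.log (1 + Real.exp (x i))) := by
    refine ⟨⟨w, hw, hs, rfl⟩, ?_⟩
    rintro v ⟨w', hw', hs', rfl⟩
    exact isMinOn_iff.1 hmin w' ⟨hw', hs'⟩
  rw [hprimal.csInf_eq]
  symm
  apply IsGreatest.csSup_eq
  refine ⟨⟨_, fun i => -q i, hu, hfirst, hval⟩, ?_⟩
  rintro v ⟨r, u, hu', hr, rfl⟩
  exact weak w hw hs r u hu' hr
end

section
/- (Conjugate of the logistic loss, infinite branch.) For every u ∈ ℝ with u > 0 or u < −1, the function x ↦ u·x − log(1 + exp(−x)) is unbounded above on ℝ; that is, the convex conjugate of the logistic loss at u is +∞. -/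
/-- The logistic loss exceeds the hinge function `max 0 (-x)` by at most `log 2`. -/
theorem log_one_add_exp_neg_le (x : ℝ) :
    Real.log (1 + Real.exp (-x)) ≤ Real.log 2 + max 0 (-x) := by
  have hmax : 0 < Real.exp (max 0 (-x)) := Real.exp_pos _
  rw [← Real.log_exp (max 0 (-x)), ← Real.log_mul two_ne_zero hmax.ne']
  apply Real.log_le_log (by positivity)
  have h₁ : 1 ≤ Real.exp (max 0 (-x)) := Real.one_le_exp (le_max_left _ _)
  have h₂ : Real.exp (-x) ≤ Real.exp (max 0 (-x)) := Real.exp_le_exp.2 (le_max_right _ _)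
  linarith

/-- Conjugate of the logistic loss, infinite branch: for `u > 0` or `u < -1`,
the function `x ↦ u * x - log (1 + exp (-x))` is unbounded above on ℝ, i.e. the
convex conjugate of the logistic loss at `u` is `+∞`. -/
theorem logistic_loss_conjugate_infinite (u : ℝ) (hu : 0 < u ∨ u < -1) :
    ∀ C : ℝ, ∃ x : ℝ, C < u * x - Real.log (1 + Real.exp (-x)) := by
  intro C
  have hC : 0 < |C| + Real.log 2 + 1 := by positivity
  rcases hu with hu | hu
  · refine ⟨(|C| + Real.log 2 + 1) / u, ?_⟩
    have hx : 0 < (|C| + Real.log 2 + 1) / u := div_pos hC hu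
    have hle := log_one_add_exp_neg_le ((|C| + Real.log 2 + 1) / u)
    rw [max_eq_left (by linarith)] at hle
    rw [mul_div_cancel₀ _ hu.ne']
    linarith [le_abs_self C]
  · have hu' : u + 1 < 0 := by linarith
    refine ⟨(|C| + Real.log 2 + 1) / (u + 1), ?_⟩
    have hx : (|C| + Real.log 2 + 1) / (u + 1) < 0 := div_neg_of_pos_of_neg hC hu'
    have hle := log_one_add_exp_neg_le ((|C| + Real.log 2 + 1) / (u + 1))
    rw [max_eq_right (by linarith)] at hle
    have hmul : (u + 1) * ((|C| + Real.log 2 + 1) / (u + 1)) = |C| + Real.log 2 + 1 :=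
      mul_div_cancel₀ _ hu'.ne
    linarith [le_abs_self C]
end
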